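/- Let N ≥ 2, n ≥ 1, A₁,…,A_N ∈ ℝ^{n×n}, Â = diag(A₁,…,A_N), and let R = √N·V for a real orthogonal N×N matrix V whose first column is (1/√N)·𝟙_N, with R⁻¹ = (1/N)·Rᵀ and lower-right (N−1)×(N−1) block R₂₂ of R⁻¹. Writing Ψ := (R⁻¹ ⊗ I_n)·Â·(R ⊗ I_n) in blocks, the bottom-right block is Ψ₂₂ = N·(R₂₂ ⊗ I_n)·H·(R₂₂ᵀ ⊗ I_n), where H = (𝟙_{N−1}𝟙_{N−1}ᵀ ⊗ A₁) + diag(A₂,…,A_N). -/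

import Mathlib

open Matrix
open scoped Kronecker

noncomputable section

/-- The index `0` of `Fin N` when `N ≥ 2`. -/
def e0 {N : ℕ} (hN : 2 ≤ N) : Fin N := ⟨0, by omega⟩

/-- The embedding `Fin (N-1) → Fin N`, `i ↦ i + 1`. -/
def emb {N : ℕ} (hN : 2 ≤ N) (i : Fin (N - 1)) : Fin N :=
  ⟨i.1 + 1, by have := i.2; omega⟩

/-- Given an orthogonal matrix `V`, `Rinv V = (1/N)·Rᵀ` where `R = √N·V`. -/
def Rinv {N : ℕ} (V : Matrix (Fin N) (Fin N) ℝ) : Matrix (Fin N) (Fin N) ℝ :=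
  (1 / (N : ℝ)) • (Real.sqrt N • V).transpose

/-- The lower-right `(N-1)×(N-1)` block of `R⁻¹`. -/
def R22 {N : ℕ} (hN : 2 ≤ N) (V : Matrix (Fin N) (Fin N) ℝ) :
    Matrix (Fin (N - 1)) (Fin (N - 1)) ℝ :=
  Matrix.of fun i j => Rinv V (emb hN i) (emb hN j)

/-- The block-diagonal matrix `diag(A₁,…,A_N)` on `ℝ^{nN}`. -/
def blockDiag {N n : ℕ} (A : Fin N → Matrix (Fin n) (Fin n) ℝ) :
    Matrix (Fin N × Fin n) (Fin N × Fin n) ℝ :=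
  Matrix.of fun p q => if p.1 = q.1 then A p.1 p.2 q.2 else 0

/-- `Ψ = (R⁻¹ ⊗ I_n)·Â·(R ⊗ I_n)` where `R = √N·V` and `Â = diag(A₁,…,A_N)`. -/
def PsiM {N n : ℕ} (V : Matrix (Fin N) (Fin N) ℝ)
    (A : Fin N → Matrix (Fin n) (Fin n) ℝ) :
    Matrix (Fin N × Fin n) (Fin N × Fin n) ℝ :=
  (Rinv V ⊗ₖ (1 : Matrix (Fin n) (Fin n) ℝ)) * blockDiag A *
    ((Real.sqrt N • V) ⊗ₖ (1 : Matrix (Fin n) (Fin n) ℝ))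

/-- The `k×k` all-ones matrix `𝟙𝟙ᵀ`. -/
def onesM (k : ℕ) : Matrix (Fin k) (Fin k) ℝ := Matrix.of fun _ _ => 1

theorem sum_eq_e0_add_sum_emb {N : ℕ} (hN : 2 ≤ N) (f : Fin N → ℝ) :
    ∑ k, f k = f (e0 hN) + ∑ k, f (emb hN k) := by
  cases N with
  | zero => omega
  | succ M => exact Fin.sum_univ_succ f

theorem kronecker_one_mul_blockDiag_mul_kronecker_one {N n : ℕ}
    (P Q : Matrix (Fin N) (Fin N) ℝ) (A : Fin N → Matrix (Fin n) (Fin n) ℝ)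
    (p q : Fin N × Fin n) :
    ((P ⊗ₖ (1 : Matrix (Fin n) (Fin n) ℝ)) * _root_.blockDiag A *
      (Q ⊗ₖ (1 : Matrix (Fin n) (Fin n) ℝ))) p q =
      ∑ k, P p.1 k * Q k q.1 * A k p.2 q.2 := by
  simp only [Matrix.mul_apply, Fintype.sum_prod_type, kroneckerMap_apply, _root_.blockDiag,
    Matrix.of_apply, Matrix.one_apply, mul_ite, ite_mul, mul_one, mul_zero, zero_mul,
    Finset.sum_ite_eq', Finset.mem_univ, if_true]
  refine Finset.sum_congr rfl fun k _ => ?_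
  rw [Finset.sum_eq_single k (fun x _ hx => by simp [hx]) (by simp)]
  simp only [if_true, Finset.sum_ite_eq, Finset.mem_univ]
  ring

theorem kronecker_one_mul_onesM_mul_kronecker_one {N n : ℕ}
    (P Q : Matrix (Fin N) (Fin N) ℝ) (B : Matrix (Fin n) (Fin n) ℝ) (p q : Fin N × Fin n) :
    ((P ⊗ₖ (1 : Matrix (Fin n) (Fin n) ℝ)) * (onesM N ⊗ₖ B) *
      (Q ⊗ₖ (1 : Matrix (Fin n) (Fin n) ℝ))) p q =
      (∑ k, P p.1 k) * (∑ k, Q k q.1) * B p.2 q.2 := by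
  rw [← mul_kronecker_mul, ← mul_kronecker_mul, Matrix.one_mul, Matrix.mul_one,
    kroneckerMap_apply]
  simp [Matrix.mul_apply, onesM, Finset.mul_sum]

theorem Rinv_apply_eq_div_sqrt {N : ℕ} (V : Matrix (Fin N) (Fin N) ℝ) (i j : Fin N) :
    Rinv V i j = V j i / Real.sqrt N := by
  simp only [Rinv, Matrix.smul_apply, transpose_apply, smul_eq_mul]
  rw [← mul_assoc, one_div_mul_eq_div, Real.sqrt_div_self, inv_mul_eq_div]

/-- The columns of an orthogonal matrix other than the constant one sum to zero. -/
theorem sum_col_emb_eq_neg {N : ℕ} (hN : 2 ≤ N) (V : Matrix (Fin N) (Fin N) ℝ)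
    (hV : V.transpose * V = 1) (hcol : ∀ i : Fin N, V i (e0 hN) = 1 / Real.sqrt N)
    (j : Fin (N - 1)) :
    ∑ k, V (emb hN k) (emb hN j) = -V (e0 hN) (emb hN j) := by
  have hs : Real.sqrt N ≠ 0 := Real.sqrt_ne_zero'.2 (by exact_mod_cast (by omega : 0 < N))
  have hne : e0 hN ≠ emb hN j := by simp [e0, emb]
  have h := congrFun (congrFun hV (e0 hN)) (emb hN j)
  simp only [Matrix.mul_apply, transpose_apply, hcol, Matrix.one_apply_ne hne,
    ← Finset.mul_sum] at h
  have h0 := (mul_eq_zero.1 h).resolve_left (one_div_ne_zero hs)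
  rw [sum_eq_e0_add_sum_emb hN] at h0
  linarith

/-- The bottom-right block of `Ψ = (R⁻¹ ⊗ I_n)·Â·(R ⊗ I_n)` is
`Ψ₂₂ = N·(R₂₂ ⊗ I_n)·H·(R₂₂ᵀ ⊗ I_n)` with
`H = (𝟙𝟙ᵀ ⊗ A₁) + diag(A₂,…,A_N)`. -/
theorem stmt_9 {N n : ℕ} (hN : 2 ≤ N) (hn : 1 ≤ n)
    (A : Fin N → Matrix (Fin n) (Fin n) ℝ)
    (V : Matrix (Fin N) (Fin N) ℝ)
    (hV : V.transpose * V = 1)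
    (hcol : ∀ i : Fin N, V i (e0 hN) = 1 / Real.sqrt N) :
    let H : Matrix (Fin (N - 1) × Fin n) (Fin (N - 1) × Fin n) ℝ :=
      (onesM (N - 1) ⊗ₖ A (e0 hN)) + blockDiag (fun j => A (emb hN j))
    (Matrix.of fun (p q : Fin (N - 1) × Fin n) =>
        PsiM V A (emb hN p.1, p.2) (emb hN q.1, q.2)) =
      (N : ℝ) • (((R22 hN V) ⊗ₖ (1 : Matrix (Fin n) (Fin n) ℝ)) * H *
        ((R22 hN V).transpose ⊗ₖ (1 : Matrix (Fin n) (Fin n) ℝ))) := by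
  intro H
  have hs : Real.sqrt N ≠ 0 := Real.sqrt_ne_zero'.2 (by exact_mod_cast (by omega : 0 < N))
  have hsq : (N : ℝ) = Real.sqrt N * Real.sqrt N := (Real.mul_self_sqrt N.cast_nonneg).symm
  ext p q
  rw [Matrix.of_apply, Matrix.smul_apply, PsiM, kronecker_one_mul_blockDiag_mul_kronecker_one,
    sum_eq_e0_add_sum_emb hN]
  simp only [H, Matrix.add_mul, Matrix.add_apply,
    kronecker_one_mul_blockDiag_mul_kronecker_one, kronecker_one_mul_onesM_mul_kronecker_one,
    R22, Matrix.of_apply, transpose_apply, Rinv_apply_eq_div_sqrt, Matrix.smul_apply, smul_eq_mul,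
    ← Finset.sum_div, sum_col_emb_eq_neg hN V hV hcol, mul_add, Finset.mul_sum]
  congr 1
  · rw [hsq]
    simp only [Real.sqrt_mul_self (Real.sqrt_nonneg _)]
    field_simp
  · refine Finset.sum_congr rfl fun k _ => ?_
    rw [hsq]
    simp only [Real.sqrt_mul_self (Real.sqrt_nonneg _)]
    field_simp

end
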